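/- Let (X, f_{0,∞}) be a non-autonomous dynamical system on a compact metric space. Then (X, f_{0,∞}) has shadowing if and only if the induced hyperspace system (K(X), \bar f_{0,∞}) has shadowing. -/

import Mathlib

open Filter Topology TopologicalSpace

/-- `comps f n` is `f_0^n = f_{n-1} ∘ ⋯ ∘ f_0`. -/
def comps {X : Type*} (f : ℕ → X → X) : ℕ → X → X
  | 0 => id
  | n + 1 => f n ∘ comps f n

/-- The non-autonomous system `(X, f_{0,∞})` has shadowing: for every `ε > 0` there is
`δ > 0` such that every (infinite) `δ`-pseudo orbit `{c n}` is `ε`-shadowed by a point. -/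
def Shadowing {X : Type*} [MetricSpace X] (f : ℕ → X → X) : Prop :=
  ∀ ε > (0 : ℝ), ∃ δ > (0 : ℝ), ∀ c : ℕ → X,
    (∀ n : ℕ, dist (f n (c n)) (c (n + 1)) < δ) →
    ∃ y : X, ∀ n : ℕ, dist (comps f n y) (c n) < ε

theorem exists_orbit_through {X : Type*} (n : ℕ) : ∀ (K : ℕ → Set X) (R : ℕ → X → X → Prop)
    (_ : ∀ n, ∀ x ∈ K n, ∃ y ∈ K (n + 1), R n x y)
    (_ : ∀ n, ∀ y ∈ K (n + 1), ∃ x ∈ K n, R n x y) (x : X) (_ : x ∈ K n),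
    ∃ c : ℕ → X, (∀ k, c k ∈ K k) ∧ (∀ k, R k (c k) (c (k + 1))) ∧ c n = x := by
  induction n with
  | zero =>
    intro K R hfw _ x hx
    have : Nonempty X := ⟨x⟩
    choose! g hg hR using hfw
    let c : ℕ → X := fun k => Nat.rec x (fun k y => g k y) k
    have hc : ∀ k, c k ∈ K k := by
      intro k
      induction k with
      | zero => exact hx
      | succ k ih => exact hg k _ ih
    exact ⟨c, hc, fun k => hR k _ (hc k), rfl⟩
  | succ n ih =>
    intro K R hfw hbw x hx
    obtain ⟨c, h1, h2, h3⟩ := ih (fun k => K (k + 1)) (fun k => R (k + 1))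
      (fun k => hfw (k + 1)) (fun k => hbw (k + 1)) x hx
    obtain ⟨z, hz, hzR⟩ := hbw 0 (c 0) (h1 0)
    refine ⟨fun k => Nat.casesOn k z c, ?_, ?_, h3⟩
    · intro k
      cases k with
      | zero => exact hz
      | succ k => exact h1 k
    · intro k
      cases k with
      | zero => exact hzR
      | succ k => exact h2 k

theorem continuous_comps {X : Type*} [MetricSpace X]
    (f : ℕ → X → X) (hf : ∀ n, Continuous (f n)) (n : ℕ) : Continuous (comps f n) := by
  induction n with
  | zero => exact continuous_id
  | succ n ih => exact (hf n).comp ih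

theorem coe_comps {X : Type*} [MetricSpace X]
    (f : ℕ → X → X)
    (F : ℕ → NonemptyCompacts X → NonemptyCompacts X)
    (hF : ∀ n (K : NonemptyCompacts X), (F n K : Set X) = f n '' ↑K) (n : ℕ)
    (K : NonemptyCompacts X) : ((comps F n K : NonemptyCompacts X) : Set X) = comps f n '' ↑K := by
  induction n with
  | zero => simp [comps]
  | succ n ih =>
    change (F n (comps F n K) : Set X) = (f n ∘ comps f n) '' ↑K
    rw [hF, ih, Set.image_comp]

theorem hd_ne_top {X : Type*} [MetricSpace X] (A B : NonemptyCompacts X) :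
    Metric.hausdorffEDist (A : Set X) B ≠ ⊤ :=
  Metric.hausdorffEDist_ne_top_of_nonempty_of_bounded A.nonempty B.nonempty
    A.isCompact.isBounded B.isCompact.isBounded

/-- `(X, f_{0,∞})` has shadowing iff the induced hyperspace system `(K(X), \bar f_{0,∞})`
has shadowing, where `K(X)` is the space of nonempty compact subsets of `X` with the
Hausdorff metric and `F n` is the induced map, characterized by `F n K = f n '' K`. -/
theorem shadowing_iff_hyperspace {X : Type*} [MetricSpace X] [CompactSpace X]
    (f : ℕ → X → X) (hf : ∀ n, Continuous (f n))
    (F : ℕ → NonemptyCompacts X → NonemptyCompacts X)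
    (hF : ∀ n (K : NonemptyCompacts X), (F n K : Set X) = f n '' ↑K) :
    Shadowing f ↔ Shadowing F := by
  constructor
  · intro h ε hε
    obtain ⟨δ, hδ, H⟩ := h (ε / 2) (by positivity)
    refine ⟨δ, hδ, fun K hK => ?_⟩
    have thr := fun n x hx => exists_orbit_through n (fun n => (K n : Set X))
      (fun n x y => dist (f n x) y < δ) (by
        intro n x hx
        have h1 := hK n
        rw [Metric.NonemptyCompacts.dist_eq] at h1
        refine Metric.exists_dist_lt_of_hausdorffDist_lt ?_ h1 (hd_ne_top _ _)
        rw [hF]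
        exact ⟨x, hx, rfl⟩) (by
        intro n y hy
        have h1 := hK n
        rw [Metric.NonemptyCompacts.dist_eq] at h1
        obtain ⟨z, hz, hzy⟩ := Metric.exists_dist_lt_of_hausdorffDist_lt' hy h1 (hd_ne_top _ _)
        rw [hF] at hz
        obtain ⟨x, hx, rfl⟩ := hz
        exact ⟨x, hx, hzy⟩) x hx
    let Y : Set X := {y | ∀ n, Metric.infDist (comps f n y) (K n) ≤ ε / 2}
    have key : ∀ n, ∀ x ∈ (K n : Set X), ∃ y ∈ Y, dist (comps f n y) x < ε / 2 := by
      intro n x hx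
      obtain ⟨c, h1, h2, h3⟩ := thr n x hx
      obtain ⟨y, hy⟩ := H c h2
      refine ⟨y, fun k => (Metric.infDist_le_dist_of_mem (h1 k)).trans (hy k).le, ?_⟩
      rw [← h3]
      exact hy n
    have hYc : IsClosed Y := by
      have : Y = ⋂ n, {y | Metric.infDist (comps f n y) (K n) ≤ ε / 2} := by
        ext y
        simp [Y]
      rw [this]
      exact isClosed_iInter fun n => isClosed_le
        ((Metric.continuous_infDist_pt _).comp (continuous_comps f hf n)) continuous_const
    have hYn : Y.Nonempty := by
      obtain ⟨x, hx⟩ := (K 0).nonempty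
      obtain ⟨y, hy, _⟩ := key 0 x hx
      exact ⟨y, hy⟩
    refine ⟨⟨⟨Y, hYc.isCompact⟩, hYn⟩, fun n => ?_⟩
    refine lt_of_le_of_lt ?_ (half_lt_self hε)
    rw [Metric.NonemptyCompacts.dist_eq, coe_comps f F hF]
    refine Metric.hausdorffDist_le_of_infDist (by positivity) ?_ ?_
    · rintro _ ⟨y, hy, rfl⟩
      exact hy n
    · intro x hx
      obtain ⟨y, hy, hd⟩ := key n x hx
      rw [dist_comm] at hd
      exact (Metric.infDist_le_dist_of_mem (Set.mem_image_of_mem _ hy)).trans hd.le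
  · intro h ε hε
    obtain ⟨δ, hδ, H⟩ := h ε hε
    refine ⟨δ, hδ, fun c hc => ?_⟩
    obtain ⟨K, hK⟩ := H (fun n => {c n}) (by
      intro n
      rw [Metric.NonemptyCompacts.dist_eq, hF]
      simpa using hc n)
    obtain ⟨y, hy⟩ := K.nonempty
    refine ⟨y, fun n => ?_⟩
    have h1 := hK n
    rw [Metric.NonemptyCompacts.dist_eq] at h1
    obtain ⟨z, hz, hd⟩ := Metric.exists_dist_lt_of_hausdorffDist_lt
      (x := comps f n y) (by rw [coe_comps f F hF]; exact ⟨y, hy, rfl⟩) h1 (hd_ne_top _ _)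
    have hz' : z = c n := by simpa using hz
    rwa [hz'] at hd
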